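/- arXiv:1206.1156 — 9 statements merged into one kernel-verified Lean document; each statement's English description precedes it below -/
import Mathlib

section
/- (Moreau identity in H_V) Let V be a symmetric positive definite N×N real matrix, h ∈ Γ₀(ℝ^N), and 0 < ρ < ∞. Then for every x ∈ ℝ^N, prox^V_{ρh*}(x) + ρ V⁻¹ (prox^{V⁻¹}_{h/ρ}(Vx/ρ)) = x, where h* is the Fenchel conjugate of h. -/
open Matrix

noncomputable section

/-- `h` is proper, lower semicontinuous and convex with values in `ℝ ∪ {+∞}` (never `⊥`). -/
def Gamma0 {N : ℕ} (h : (Fin N → ℝ) → EReal) : Prop :=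
  (∃ x, h x ≠ ⊤) ∧ (∀ x, h x ≠ ⊥) ∧ LowerSemicontinuous h ∧
    ∀ x y : Fin N → ℝ, ∀ a b : ℝ, 0 ≤ a → 0 ≤ b → a + b = 1 →
      h (a • x + b • y) ≤ (a : EReal) * h x + (b : EReal) * h y

/-- The objective `z ↦ (1/2)‖x − z‖²_V + h(z)`. -/
def proxObj {N : ℕ} (V : Matrix (Fin N) (Fin N) ℝ) (h : (Fin N → ℝ) → EReal)
    (x z : Fin N → ℝ) : EReal :=
  (((1 : ℝ) / 2 * ((x - z) ⬝ᵥ V.mulVec (x - z)) : ℝ) : EReal) + h z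

/-- `p = prox^V_h(x)`: `p` is the unique minimizer of `z ↦ (1/2)‖x − z‖²_V + h(z)`. -/
def IsProx {N : ℕ} (V : Matrix (Fin N) (Fin N) ℝ) (h : (Fin N → ℝ) → EReal)
    (x p : Fin N → ℝ) : Prop :=
  (∀ z, proxObj V h x p ≤ proxObj V h x z) ∧
    ∀ q, (∀ z, proxObj V h x q ≤ proxObj V h x z) → q = p

/-- The Fenchel conjugate `h*(v) = sup_x ⟨v,x⟩ − h(x)`. -/
def fenchel {N : ℕ} (h : (Fin N → ℝ) → EReal) (v : Fin N → ℝ) : EReal :=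
  ⨆ x : Fin N → ℝ, ((v ⬝ᵥ x : ℝ) : EReal) - h x

/-- Expansion of the quadratic form of a symmetric matrix at a difference of vectors. -/
theorem dotProduct_mulVec_sub_self {N : ℕ} {A : Matrix (Fin N) (Fin N) ℝ} (hA : Aᵀ = A)
    (a b : Fin N → ℝ) :
    (a - b) ⬝ᵥ A.mulVec (a - b) =
      a ⬝ᵥ A.mulVec a - 2 * (b ⬝ᵥ A.mulVec a) + b ⬝ᵥ A.mulVec b := by
  have hsymm : a ⬝ᵥ A.mulVec b = b ⬝ᵥ A.mulVec a := by
    rw [dotProduct_mulVec, ← mulVec_transpose, hA, dotProduct_comm]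
  simp only [mulVec_sub, dotProduct_sub, sub_dotProduct]
  rw [hsymm]
  ring

/-- If `t * a + t ^ 2 * b` is nonnegative for all `t` in `(0, 1]`, then `a` is nonnegative. -/
theorem nonneg_of_forall_mul_add_sq_mul_nonneg {a b : ℝ}
    (h : ∀ t : ℝ, 0 < t → t ≤ 1 → 0 ≤ t * a + t ^ 2 * b) : 0 ≤ a := by
  by_contra! ha
  have hd : 0 < |b| + |a| + 1 := by positivity
  have hna : |a| = -a := abs_of_neg ha
  have ht : 0 < -a / (|b| + |a| + 1) := div_pos (by linarith) hd
  have h1 := h _ ht ((div_le_one hd).2 (by linarith [abs_nonneg b]))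
  set t := -a / (|b| + |a| + 1)
  have htm : t * (|b| + |a| + 1) = -a := div_mul_cancel₀ _ hd.ne'
  have h2 : 0 ≤ a + t * b := by
    refine nonneg_of_mul_nonneg_right (a := t) ?_ ht
    linarith [h1, show t * (a + t * b) = t * a + t ^ 2 * b by ring]
  nlinarith [mul_le_mul_of_nonneg_left (le_abs_self b) ht.le,
    mul_nonneg ht.le (abs_nonneg a)]

/-- A minimizer of the objective defining the proximal operator lies in the domain. -/
theorem ne_top_of_proxObj_minimizer {N : ℕ} {A : Matrix (Fin N) (Fin N) ℝ}
    {h : (Fin N → ℝ) → EReal} (hh : Gamma0 h) {c : ℝ} (hc : 0 < c) {u q : Fin N → ℝ}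
    (hq : ∀ z, proxObj A (fun z => (c : EReal) * h z) u q ≤
      proxObj A (fun z => (c : EReal) * h z) u z) : h q ≠ ⊤ := by
  intro htop
  obtain ⟨y, hy⟩ := hh.1
  lift h y to ℝ using ⟨hy, hh.2.1 y⟩ with s hs
  have := hq y
  simp only [proxObj, htop, ← hs, EReal.coe_mul_top_of_pos hc, EReal.coe_add_top, top_le_iff]
    at this
  exact EReal.coe_ne_top _ (by exact_mod_cast this)

/-- The optimality condition for the proximal operator: the scaled residual is a subgradient. -/
theorem subgradient_of_proxObj_minimizer {N : ℕ} {A : Matrix (Fin N) (Fin N) ℝ} (hA : Aᵀ = A)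
    {h : (Fin N → ℝ) → EReal} (hh : Gamma0 h) {c : ℝ} (hc : 0 < c) {u q : Fin N → ℝ} {r : ℝ}
    (hr : h q = r)
    (hq : ∀ z, proxObj A (fun z => (c : EReal) * h z) u q ≤
      proxObj A (fun z => (c : EReal) * h z) u z) (z : Fin N → ℝ) :
    ((r + c⁻¹ * ((z - q) ⬝ᵥ A.mulVec (u - q)) : ℝ) : EReal) ≤ h z := by
  by_cases hz : h z = ⊤
  · simp [hz]
  lift h z to ℝ using ⟨hz, hh.2.1 z⟩ with s hs
  rw [EReal.coe_le_coe_iff]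
  have key : 0 ≤ c * (s - r) - (z - q) ⬝ᵥ A.mulVec (u - q) := by
    refine nonneg_of_forall_mul_add_sq_mul_nonneg
      (b := 1 / 2 * ((z - q) ⬝ᵥ A.mulVec (z - q))) fun t ht ht1 => ?_
    have hconv := hh.2.2.2 q z (1 - t) t (by linarith) ht.le (by ring)
    have hmin := hq ((1 - t) • q + t • z)
    have htop : h ((1 - t) • q + t • z) ≠ ⊤ := by
      intro h1
      rw [h1, hr, ← hs, top_le_iff] at hconv
      exact EReal.coe_ne_top ((1 - t) * r + t * s) (by exact_mod_cast hconv)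
    lift h ((1 - t) • q + t • z) to ℝ using ⟨htop, hh.2.1 _⟩ with w hw
    rw [hr, ← hs] at hconv
    simp only [proxObj, hr, ← hw] at hmin
    norm_cast at hconv hmin
    have hdiff : u - ((1 - t) • q + t • z) = (u - q) - t • (z - q) := by
      module
    rw [hdiff, dotProduct_mulVec_sub_self hA (u - q) (t • (z - q))] at hmin
    simp only [mulVec_smul, dotProduct_smul, smul_dotProduct, smul_eq_mul] at hmin
    nlinarith [mul_le_mul_of_nonneg_left hconv hc.le]
  have h2 : c⁻¹ * ((z - q) ⬝ᵥ A.mulVec (u - q)) ≤ c⁻¹ * (c * (s - r)) :=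
    mul_le_mul_of_nonneg_left (by linarith) (by positivity)
  rw [inv_mul_cancel_left₀ hc.ne'] at h2
  linarith

/-- The Fenchel–Young inequality at a point with finite value. -/
theorem le_fenchel {N : ℕ} {h : (Fin N → ℝ) → EReal} {q : Fin N → ℝ} {r : ℝ} (hr : h q = r)
    (v : Fin N → ℝ) : ((v ⬝ᵥ q - r : ℝ) : EReal) ≤ fenchel h v := by
  have := le_iSup (fun x : Fin N → ℝ => ((v ⬝ᵥ x : ℝ) : EReal) - h x) q
  rwa [hr, ← EReal.coe_sub] at this

/-- The Fenchel–Young inequality is an equality at a subgradient. -/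
theorem fenchel_eq_of_subgradient {N : ℕ} {h : (Fin N → ℝ) → EReal} {q v : Fin N → ℝ} {r : ℝ}
    (hr : h q = r) (hv : ∀ z, ((r + v ⬝ᵥ (z - q) : ℝ) : EReal) ≤ h z) :
    fenchel h v = ((v ⬝ᵥ q - r : ℝ) : EReal) := by
  refine le_antisymm (iSup_le fun z => ?_) (le_fenchel hr v)
  refine (EReal.sub_le_sub le_rfl (hv z)).trans ?_
  rw [← EReal.coe_sub, EReal.coe_le_coe_iff, dotProduct_sub]
  linarith

/-- Moreau identity in `H_V`:
`prox^V_{ρh*}(x) + ρ V⁻¹ (prox^{V⁻¹}_{h/ρ}(Vx/ρ)) = x`. -/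
theorem moreau_identity_scaled {N : ℕ} (V : Matrix (Fin N) (Fin N) ℝ)
    (hV : V.PosDef) (h : (Fin N → ℝ) → EReal) (hh : Gamma0 h)
    (ρ : ℝ) (hρ : 0 < ρ) (x p q : Fin N → ℝ)
    (hp : IsProx V (fun z => (ρ : EReal) * fenchel h z) x p)
    (hq : IsProx V⁻¹ (fun z => ((ρ⁻¹ : ℝ) : EReal) * h z) (ρ⁻¹ • V.mulVec x) q) :
    p + ρ • V⁻¹.mulVec q = x := by
  have hVt : Vᵀ = V := by simpa [IsHermitian] using hV.isHermitian
  have hdet : IsUnit V.det := hV.det_pos.ne'.isUnit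
  have hVit : V⁻¹ᵀ = V⁻¹ := by rw [transpose_nonsing_inv, hVt]
  have hρi : 0 < ρ⁻¹ := inv_pos.2 hρ
  obtain ⟨r, hr⟩ : ∃ r : ℝ, h q = r :=
    ⟨_, (EReal.coe_toReal (ne_top_of_proxObj_minimizer hh hρi hq.1) (hh.2.1 q)).symm⟩
  have hres : V⁻¹.mulVec (ρ⁻¹ • V.mulVec x - q) = ρ⁻¹ • (x - ρ • V⁻¹.mulVec q) := by
    rw [mulVec_sub, mulVec_smul, mulVec_mulVec, nonsing_inv_mul _ hdet, one_mulVec, smul_sub,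
      inv_smul_smul₀ hρ.ne']
  have hsub : ∀ z, ((r + (x - ρ • V⁻¹.mulVec q) ⬝ᵥ (z - q) : ℝ) : EReal) ≤ h z := fun z => by
    have := subgradient_of_proxObj_minimizer hVit hh hρi hr hq.1 z
    rwa [hres, dotProduct_smul, smul_eq_mul, inv_mul_cancel_left₀ hρi.ne', dotProduct_comm]
      at this
  suffices x - ρ • V⁻¹.mulVec q = p by rw [← this, sub_add_cancel]
  refine hp.2 _ fun z => ?_
  have hfen : ((ρ * (z ⬝ᵥ q - r) : ℝ) : EReal) ≤ (ρ : EReal) * fenchel h z := by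
    rw [EReal.coe_mul]
    exact mul_le_mul_of_nonneg_left (le_fenchel hr z) (by exact_mod_cast hρ.le)
  simp only [proxObj, fenchel_eq_of_subgradient hr hsub]
  refine le_trans ?_ (add_le_add le_rfl hfen)
  norm_cast
  set v := x - ρ • V⁻¹.mulVec q with hv
  have hxv : V.mulVec (x - v) = ρ • q := by
    rw [hv, sub_sub_cancel, mulVec_smul, mulVec_mulVec, mul_nonsing_inv _ hdet, one_mulVec]
  have hnonneg : 0 ≤ (z - v) ⬝ᵥ V.mulVec (z - v) := by
    simpa using hV.posSemidef.dotProduct_mulVec_nonneg (z - v)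
  have hexp := dotProduct_mulVec_sub_self hVt (x - v) (z - v)
  rw [sub_sub_sub_cancel_right, hxv, dotProduct_smul, dotProduct_smul, sub_dotProduct z,
    smul_eq_mul, smul_eq_mul] at hexp
  rw [hxv, dotProduct_smul, smul_eq_mul]
  linarith
end
end

section
/- Let V be a symmetric positive definite N×N real matrix and h ∈ Γ₀(ℝ^N). Then for every x ∈ ℝ^N, prox^V_h(x) = x − V⁻¹ (prox^{V⁻¹}_{h*}(Vx)), where h* is the Fenchel conjugate of h. -/
open Matrix

noncomputable section

/-- Expansion of the quadratic form of a symmetric matrix at `u + t • d`. -/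
theorem quadForm_add_smul {N : ℕ} {V : Matrix (Fin N) (Fin N) ℝ} (hV : V.IsSymm)
    (u d : Fin N → ℝ) (t : ℝ) :
    (u + t • d) ⬝ᵥ V.mulVec (u + t • d) =
      u ⬝ᵥ V.mulVec u + 2 * t * (V.mulVec u ⬝ᵥ d) + t ^ 2 * (d ⬝ᵥ V.mulVec d) := by
  have hs : u ⬝ᵥ V.mulVec d = V.mulVec u ⬝ᵥ d := by
    rw [dotProduct_mulVec, ← mulVec_transpose, hV.eq]
  simp only [mulVec_add, mulVec_smul, add_dotProduct, dotProduct_add, smul_dotProduct,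
    dotProduct_smul, smul_eq_mul, hs, dotProduct_comm d (V.mulVec u)]
  ring

/-- A minimizer of the proximal objective of a proper function lies in its domain. -/
theorem exists_real_of_proxObj_le {N : ℕ} {V : Matrix (Fin N) (Fin N) ℝ}
    {h : (Fin N → ℝ) → EReal} (hh : Gamma0 h) {x p : Fin N → ℝ}
    (hp : ∀ z, proxObj V h x p ≤ proxObj V h x z) : ∃ r : ℝ, h p = r := by
  obtain ⟨⟨z, hz⟩, hbot, -⟩ := hh
  refine ⟨(h p).toReal, (EReal.coe_toReal (fun htop => ?_) (hbot p)).symm⟩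
  have hle := hp z
  rw [proxObj, proxObj, htop, EReal.coe_add_top, top_le_iff] at hle
  exact EReal.add_ne_top (EReal.coe_ne_top _) hz hle

/-- Optimality condition: if `p` minimizes the proximal objective at `x`, then `V (x - p)` is a
subgradient of `h` at `p`. -/
theorem subgradient_of_proxObj_le {N : ℕ} {V : Matrix (Fin N) (Fin N) ℝ} (hV : V.IsSymm)
    {h : (Fin N → ℝ) → EReal} (hh : Gamma0 h) {x p : Fin N → ℝ}
    (hp : ∀ z, proxObj V h x p ≤ proxObj V h x z) {r s : ℝ} (hr : h p = r)
    {z : Fin N → ℝ} (hs : h z = s) :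
    r + V.mulVec (x - p) ⬝ᵥ (z - p) ≤ s := by
  set a := V.mulVec (x - p) ⬝ᵥ (z - p) with ha
  set c := (z - p) ⬝ᵥ V.mulVec (z - p) with hc
  have key : ∀ t : ℝ, 0 < t → t ≤ 1 → r + a ≤ s + t * (c / 2) := by
    intro t ht ht1
    have hconv := hh.2.2.2 p z (1 - t) t (by linarith) ht.le (by ring)
    have hle := (hp ((1 - t) • p + t • z)).trans (add_le_add le_rfl hconv)
    have hx : x - ((1 - t) • p + t • z) = (x - p) + (-t) • (z - p) := by
      module
    rw [proxObj, hx, quadForm_add_smul hV, hr, hs, ← ha, ← hc] at hle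
    norm_cast at hle
    have hmul : t * (r + a) ≤ t * (s + t * (c / 2)) := by linarith
    exact le_of_mul_le_mul_left hmul ht
  have hlim : Filter.Tendsto (fun t : ℝ => s + t * (c / 2)) (nhdsWithin 0 (Set.Ioi 0))
      (nhds s) := by
    have hcont : Continuous fun t : ℝ => s + t * (c / 2) := by fun_prop
    simpa using (hcont.tendsto 0).mono_left nhdsWithin_le_nhds
  refine ge_of_tendsto hlim ?_
  filter_upwards [Ioc_mem_nhdsGT (zero_lt_one' ℝ)] with t ht using key t ht.1 ht.2

/-- Fenchel's equality at a subgradient. -/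
theorem fenchel_le_of_subgradient {N : ℕ} {h : (Fin N → ℝ) → EReal} (hbot : ∀ z, h z ≠ ⊥)
    {p v : Fin N → ℝ} {r : ℝ}
    (hv : ∀ (z : Fin N → ℝ) (s : ℝ), h z = s → r + v ⬝ᵥ (z - p) ≤ s) :
    fenchel h v ≤ ((v ⬝ᵥ p - r : ℝ) : EReal) := by
  refine iSup_le fun z => ?_
  by_cases hz : h z = ⊤
  · simp [hz]
  · have hs := (EReal.coe_toReal hz (hbot z)).symm
    have hle := hv z _ hs
    rw [hs]
    rw [dotProduct_sub] at hle
    norm_cast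
    linarith

/-- `prox^V_h(x) = x − V⁻¹ (prox^{V⁻¹}_{h*}(Vx))`. -/
theorem prox_eq_sub_conjProx {N : ℕ} (V : Matrix (Fin N) (Fin N) ℝ)
    (hV : V.PosDef) (h : (Fin N → ℝ) → EReal) (hh : Gamma0 h)
    (x p q : Fin N → ℝ)
    (hp : IsProx V h x p)
    (hq : IsProx V⁻¹ (fenchel h) (V.mulVec x) q) :
    p = x - V⁻¹.mulVec q := by
  have hsymm : V.IsSymm := by simpa using hV.isHermitian
  have hdet : IsUnit V.det := hV.isUnit.map Matrix.detMonoidHom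
  have hsymm' : V⁻¹.IsSymm := by simpa using hV.inv.isHermitian
  obtain ⟨r, hr⟩ := exists_real_of_proxObj_le hh hp.1
  have hinv : ∀ y, V⁻¹.mulVec (V.mulVec y) = y := fun y => by
    rw [mulVec_mulVec, nonsing_inv_mul V hdet, one_mulVec]
  set v := V.mulVec (x - p) with hv
  have hconj : fenchel h v ≤ ((v ⬝ᵥ p - r : ℝ) : EReal) :=
    fenchel_le_of_subgradient hh.2.1 fun z s hs =>
      subgradient_of_proxObj_le hsymm hh hp.1 hr hs
  have hvq : v = q := hq.2 v fun w => by
    have hyoung : ((w ⬝ᵥ p - r : ℝ) : EReal) ≤ fenchel h w := by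
      have hle := le_iSup (fun y : Fin N → ℝ => ((w ⬝ᵥ y : ℝ) : EReal) - h y) p
      simpa only [fenchel, hr, ← EReal.coe_sub] using hle
    refine (add_le_add le_rfl hconj).trans (le_trans ?_ (add_le_add le_rfl hyoung))
    have hxv : V.mulVec x - v = V.mulVec p := by rw [hv, mulVec_sub, sub_sub_cancel]
    have hxw : V.mulVec x - w = V.mulVec p + (1 : ℝ) • (v - w) := by
      rw [← hxv]; module
    have hnonneg : 0 ≤ (v - w) ⬝ᵥ V⁻¹.mulVec (v - w) := by
      simpa using hV.inv.posSemidef.dotProduct_mulVec_nonneg (v - w)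
    rw [hxv, hxw, quadForm_add_smul hsymm', hinv]
    rw [dotProduct_sub, dotProduct_comm p v, dotProduct_comm p w]
    norm_cast
    linarith
  rw [← hvq, hv, hinv, sub_sub_cancel]
end
end

section
/- (Proximity operator in H_V, diagonal plus rank one) Let h ∈ Γ₀(ℝ^N), D a diagonal matrix with strictly positive diagonal entries d₁,…,d_N, u ∈ ℝ^N, and V = D + uuᵀ. Fix x ∈ ℝ^N and define p(α) = ⟨u, x − D^{-1/2}(prox_{h∘D^{-1/2}}(D^{1/2}(x − αD⁻¹u)))⟩ + α. If α is a root of p and v = α D^{-1/2}u, then prox^V_h(x) = D^{-1/2}(prox_{h∘D^{-1/2}}(D^{1/2}x − v)). -/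
open Matrix

noncomputable section

/-- Completing the square for the quadratic form of a symmetric matrix. -/
theorem dotProduct_mulVec_sub_expand {N : ℕ} {V : Matrix (Fin N) (Fin N) ℝ} (hV : V.IsSymm)
    (r s : Fin N → ℝ) :
    (r - s) ⬝ᵥ V.mulVec (r - s)
      = r ⬝ᵥ V.mulVec r - 2 * (s ⬝ᵥ V.mulVec r) + s ⬝ᵥ V.mulVec s := by
  have hsymm : r ⬝ᵥ V.mulVec s = s ⬝ᵥ V.mulVec r := by
    rw [dotProduct_mulVec, ← mulVec_transpose, hV.eq, dotProduct_comm]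
  rw [mulVec_sub, sub_dotProduct, dotProduct_sub, dotProduct_sub, hsymm]
  ring

/-- A minimizer of the proximal objective lies in the domain of `h`. -/
theorem ne_top_of_proxObj_le {N : ℕ} {V : Matrix (Fin N) (Fin N) ℝ} {h : (Fin N → ℝ) → EReal}
    {x p : Fin N → ℝ} (hne : ∃ z, h z ≠ ⊤) (hp : ∀ z, proxObj V h x p ≤ proxObj V h x z) :
    h p ≠ ⊤ := by
  obtain ⟨z, hz⟩ := hne
  intro htop
  have hle := hp z
  rw [proxObj, proxObj, htop, EReal.coe_add_top, top_le_iff] at hle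
  exact EReal.add_ne_top (EReal.coe_ne_top _) hz hle

/-- The variational inequality satisfied by a minimizer of the proximal objective. -/
theorem variational_ineq_of_proxObj_le {N : ℕ} {V : Matrix (Fin N) (Fin N) ℝ} (hV : V.IsSymm)
    {h : (Fin N → ℝ) → EReal}
    (hconv : ∀ x y : Fin N → ℝ, ∀ a b : ℝ, 0 ≤ a → 0 ≤ b → a + b = 1 →
      h (a • x + b • y) ≤ (a : EReal) * h x + (b : EReal) * h y)
    {x p : Fin N → ℝ} (hp : ∀ z, proxObj V h x p ≤ proxObj V h x z)
    {z : Fin N → ℝ} {a b : ℝ} (ha : h p = a) (hb : h z = b) :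
    (z - p) ⬝ᵥ V.mulVec (x - p) ≤ b - a := by
  set c := (z - p) ⬝ᵥ V.mulVec (x - p) with hc
  set k := (z - p) ⬝ᵥ V.mulVec (z - p) with hk
  have hstep : ∀ t : ℝ, 0 < t → t ≤ 1 → c ≤ b - a + t * (k / 2) := by
    intro t ht ht1
    have h1 := hp ((1 - t) • p + t • z)
    have h2 := hconv p z (1 - t) t (by linarith) ht.le (by ring)
    rw [ha, hb] at h2
    have h3 : x - ((1 - t) • p + t • z) = (x - p) - t • (z - p) := by module
    have h4 : proxObj V h x p ≤ _ := h1.trans (add_le_add_right h2 _)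
    rw [proxObj, ha, h3, dotProduct_mulVec_sub_expand hV (x - p) (t • (z - p))] at h4
    simp only [mulVec_smul, smul_dotProduct, dotProduct_smul, smul_eq_mul, ← hc, ← hk] at h4
    have h5 : t * c ≤ t * (b - a + t * (k / 2)) := by
      have h6 := (by exact_mod_cast h4 : (_ : ℝ) ≤ _)
      linarith
    exact le_of_mul_le_mul_left h5 ht
  have hlim : Filter.Tendsto (fun t : ℝ => b - a + t * (k / 2)) (nhdsWithin 0 (Set.Ioi 0))
      (nhds (b - a)) := by
    have : Continuous fun t : ℝ => b - a + t * (k / 2) := by fun_prop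
    simpa using (this.tendsto 0).mono_left nhdsWithin_le_nhds
  refine ge_of_tendsto hlim ?_
  filter_upwards [Ioc_mem_nhdsGT (zero_lt_one' ℝ)] with t ht
  exact hstep t ht.1 ht.2

/-- The variational inequality characterizes the proximity operator. -/
theorem isProx_of_variational_ineq {N : ℕ} {V : Matrix (Fin N) (Fin N) ℝ} (hV : V.IsSymm)
    (hpos : ∀ s : Fin N → ℝ, s ≠ 0 → 0 < s ⬝ᵥ V.mulVec s)
    {h : (Fin N → ℝ) → EReal} (hbot : ∀ z, h z ≠ ⊥)
    {x p : Fin N → ℝ} {a : ℝ} (ha : h p = a)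
    (hvar : ∀ (z : Fin N → ℝ) (b : ℝ), h z = b → (z - p) ⬝ᵥ V.mulVec (x - p) ≤ b - a) :
    IsProx V h x p := by
  have hexp : ∀ z, (x - z) ⬝ᵥ V.mulVec (x - z) = (x - p) ⬝ᵥ V.mulVec (x - p)
      - 2 * ((z - p) ⬝ᵥ V.mulVec (x - p)) + (z - p) ⬝ᵥ V.mulVec (z - p) := by
    intro z
    rw [← dotProduct_mulVec_sub_expand hV, sub_sub_sub_cancel_right]
  have hmin : ∀ z, proxObj V h x p ≤ proxObj V h x z := by
    intro z
    by_cases hz : h z = ⊤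
    · rw [proxObj, proxObj, hz, EReal.coe_add_top]
      exact le_top
    · obtain ⟨b, hb⟩ : ∃ b : ℝ, h z = b := ⟨_, (EReal.coe_toReal hz (hbot z)).symm⟩
      have hnn : 0 ≤ (z - p) ⬝ᵥ V.mulVec (z - p) := by
        by_cases h0 : z - p = 0
        · simp [h0]
        · exact (hpos _ h0).le
      have hv := hvar z b hb
      rw [proxObj, proxObj, ha, hb, hexp z]
      norm_cast
      linarith
  refine ⟨hmin, fun q hq => ?_⟩
  by_contra hne
  have hqtop : h q ≠ ⊤ := ne_top_of_proxObj_le ⟨p, by simp [ha]⟩ hq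
  obtain ⟨b, hb⟩ : ∃ b : ℝ, h q = b := ⟨_, (EReal.coe_toReal hqtop (hbot q)).symm⟩
  have hv := hvar q b hb
  have hle := hq p
  rw [proxObj, proxObj, ha, hb, hexp q] at hle
  have hle' := (by exact_mod_cast hle : (_ : ℝ) ≤ _)
  have := hpos (q - p) (sub_ne_zero.mpr hne)
  linarith

/-- Proximity operator in `H_V` with `V = D + uuᵀ` (diagonal plus rank one):
if `α` is a root of `p(α) = ⟨u, x − D^{-1/2} prox_{h∘D^{-1/2}}(D^{1/2}(x − αD⁻¹u))⟩ + α`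
and `v = α D^{-1/2} u`, then `prox^V_h(x) = D^{-1/2} prox_{h∘D^{-1/2}}(D^{1/2}x − v)`. -/
theorem prox_diag_rank_one {N : ℕ} (h : (Fin N → ℝ) → EReal) (hh : Gamma0 h)
    (d : Fin N → ℝ) (hd : ∀ i, 0 < d i) (u : Fin N → ℝ) (x : Fin N → ℝ)
    -- the diagonal matrices `D`, `D^{1/2}`, `D^{-1/2}`, `D⁻¹`
    (D Dhalf Dinvhalf Dinv : Matrix (Fin N) (Fin N) ℝ)
    (hD : D = Matrix.diagonal d)
    (hDhalf : Dhalf = Matrix.diagonal fun i => Real.sqrt (d i))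
    (hDinvhalf : Dinvhalf = Matrix.diagonal fun i => (Real.sqrt (d i))⁻¹)
    (hDinv : Dinv = Matrix.diagonal fun i => (d i)⁻¹)
    -- `V = D + uuᵀ`
    (V : Matrix (Fin N) (Fin N) ℝ) (hV : V = D + Matrix.vecMulVec u u)
    -- `P` is the proximity operator of `h ∘ D^{-1/2}` (Euclidean metric)
    (P : (Fin N → ℝ) → (Fin N → ℝ))
    (hP : ∀ w, IsProx 1 (fun z => h (Dinvhalf.mulVec z)) w (P w))
    -- `α` is a root of `p`
    (α : ℝ)
    (hroot : u ⬝ᵥ (x - Dinvhalf.mulVec (P (Dhalf.mulVec (x - α • Dinv.mulVec u)))) + α = 0) :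
    IsProx V h x (Dinvhalf.mulVec (P (Dhalf.mulVec x - α • Dinvhalf.mulVec u))) := by
  subst hD hDhalf hDinvhalf hDinv hV
  obtain ⟨⟨x₀, hx₀⟩, hbot, -, hconv⟩ := hh
  have hs : ∀ i, 0 < √(d i) := fun i => Real.sqrt_pos.mpr (hd i)
  have hsq : ∀ i, √(d i) * √(d i) = d i := fun i => Real.mul_self_sqrt (hd i).le
  set S := Matrix.diagonal fun i => √(d i) with hS
  set T := Matrix.diagonal fun i => (√(d i))⁻¹ with hT
  have hTS : ∀ z, T.mulVec (S.mulVec z) = z := by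
    intro z
    ext i
    simp [hS, hT, mulVec_diagonal, (hs i).ne']
  have harg : S.mulVec (x - α • (Matrix.diagonal fun i => (d i)⁻¹).mulVec u)
      = S.mulVec x - α • T.mulVec u := by
    ext i
    have hne := (hs i).ne'
    have hmul_self := hsq i
    simp only [hS, hT, mulVec_diagonal, Pi.sub_apply, Pi.smul_apply, smul_eq_mul]
    generalize √(d i) = r at hne hmul_self ⊢
    rw [← hmul_self]
    field_simp
  rw [harg] at hroot
  set w := S.mulVec x - α • T.mulVec u with hw
  have hmin := (hP w).1
  have htop : h (T.mulVec (P w)) ≠ ⊤ :=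
    ne_top_of_proxObj_le (h := fun z => h (T.mulVec z)) ⟨S.mulVec x₀, by simpa [hTS] using hx₀⟩ hmin
  have ha := (EReal.coe_toReal htop (hbot _)).symm
  have hsymm : (Matrix.diagonal d + vecMulVec u u).IsSymm :=
    (isSymm_diagonal d).add (transpose_vecMulVec u u)
  have hmul : ∀ r, (Matrix.diagonal d + vecMulVec u u).mulVec r = d * r + (u ⬝ᵥ r) • u := by
    intro r
    ext i
    simp [add_mulVec, mulVec_diagonal, vecMulVec_mulVec, mul_comm]
  refine isProx_of_variational_ineq hsymm ?_ hbot ha fun z b hb => ?_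
  · intro s hs0
    obtain ⟨i, hi⟩ := Function.ne_iff.mp hs0
    rw [hmul, dotProduct_add, dotProduct_smul, smul_eq_mul, dotProduct_comm s u]
    refine add_pos_of_pos_of_nonneg ?_ (mul_self_nonneg _)
    refine Finset.sum_pos' (fun j _ => ?_) ⟨i, Finset.mem_univ i, ?_⟩
    · have := mul_nonneg (hd j).le (mul_self_nonneg (s j))
      simp only [Pi.mul_apply]
      linarith
    · have := mul_pos (hd i) (mul_self_pos.mpr hi)
      simp only [Pi.mul_apply]
      linarith
  · have hgconv : ∀ y z : Fin N → ℝ, ∀ a b : ℝ, 0 ≤ a → 0 ≤ b → a + b = 1 →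
        h (T.mulVec (a • y + b • z)) ≤
          (a : EReal) * h (T.mulVec y) + (b : EReal) * h (T.mulVec z) := by
      intro y z a b h0a h0b hab
      rw [mulVec_add, mulVec_smul, mulVec_smul]
      exact hconv _ _ a b h0a h0b hab
    have hvar := variational_ineq_of_proxObj_le (h := fun z => h (T.mulVec z))
      isSymm_one hgconv hmin (z := S.mulVec z) ha (by simpa only [hTS] using hb)
    have hα : u ⬝ᵥ (x - T.mulVec (P w)) = -α := by linarith
    convert hvar using 1
    rw [hmul, hα, one_mulVec]
    refine Finset.sum_congr rfl fun i _ => ?_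
    have hne := (hs i).ne'
    have hmul_self := hsq i
    generalize P w = y
    simp only [hw, hS, hT, mulVec_diagonal, Pi.sub_apply, Pi.smul_apply, Pi.add_apply,
      Pi.mul_apply, smul_eq_mul]
    generalize √(d i) = r at hne hmul_self ⊢
    rw [← hmul_self]
    field_simp
    ring
end
end

section
/- Let h ∈ Γ₀(ℝ^N), D a diagonal matrix with strictly positive diagonal entries d₁,…,d_N, u ∈ ℝ^N, and fix x ∈ ℝ^N. The function p : ℝ → ℝ defined by p(α) = ⟨u, x − D^{-1/2}(prox_{h∘D^{-1/2}}(D^{1/2}(x − αD⁻¹u)))⟩ + α is strictly increasing on ℝ and Lipschitz continuous with Lipschitz constant 1 + Σᵢ uᵢ²/dᵢ; consequently p has a unique root. -/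
open Matrix

noncomputable section

/-- If `t * A + t ^ 2 * B` is nonnegative on `(0, 1]`, then `A` is nonnegative. -/
lemma nonneg_of_forall_add_mul_nonneg {A B : ℝ}
    (H : ∀ t : ℝ, 0 < t → t ≤ 1 → 0 ≤ t * A + t ^ 2 * B) : 0 ≤ A := by
  by_contra! hA
  have hpos : 0 < |B| - A := by linarith [abs_nonneg B]
  have hd : 0 < 2 * (|B| - A) := by positivity
  set t := -A / (2 * (|B| - A)) with ht
  have ht0 : 0 < t := div_pos (by linarith) hd
  have ht1 : t ≤ 1 := by
    rw [ht, div_le_one hd]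
    linarith [abs_nonneg B]
  have hmul : t * (2 * (|B| - A)) = -A := div_mul_cancel₀ _ hd.ne'
  have h1 := H t ht0 ht1
  have h2 : 0 ≤ t * (A + t * B) := by linarith
  have h3 : 0 ≤ A + t * B := nonneg_of_mul_nonneg_right h2 ht0
  have h4 : t * B ≤ t * |B| := mul_le_mul_of_nonneg_left (le_abs_self B) ht0.le
  nlinarith

section Prox

variable {N : ℕ}

lemma proxObj_one_ne_top {g : (Fin N → ℝ) → EReal} {w q : Fin N → ℝ}
    (hmin : ∀ z, proxObj 1 g w q ≤ proxObj 1 g w z) (hfin : ∃ z, g z ≠ ⊤) : g q ≠ ⊤ := by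
  obtain ⟨z, hz⟩ := hfin
  intro htop
  have h1 := hmin z
  unfold proxObj at h1
  rw [htop, EReal.coe_add_top, top_le_iff] at h1
  exact EReal.add_ne_top (EReal.coe_ne_top _) hz h1

/-- The variational inequality satisfied by a minimizer of the proximal objective. -/
lemma dotProduct_sub_le_of_minimizer {g : (Fin N → ℝ) → EReal}
    (hconv : ∀ x y : Fin N → ℝ, ∀ a b : ℝ, 0 ≤ a → 0 ≤ b → a + b = 1 →
      g (a • x + b • y) ≤ (a : EReal) * g x + (b : EReal) * g y)
    {w q z : Fin N → ℝ} {r s : ℝ} (hq : g q = r) (hz : g z = s)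
    (hmin : ∀ z, proxObj 1 g w q ≤ proxObj 1 g w z) :
    (w - q) ⬝ᵥ (z - q) ≤ s - r := by
  suffices 0 ≤ s - r - (w - q) ⬝ᵥ (z - q) by linarith
  refine nonneg_of_forall_add_mul_nonneg (B := 1 / 2 * ((z - q) ⬝ᵥ (z - q))) fun t ht ht1 => ?_
  have hc := hconv q z (1 - t) t (by linarith) ht.le (by ring)
  have hm := (hmin ((1 - t) • q + t • z)).trans (add_le_add_right hc _)
  rw [proxObj, hq, hz] at hm
  norm_cast at hm
  have hw : w - ((1 - t) • q + t • z) = (w - q) - t • (z - q) := by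
    ext i
    simp only [Pi.sub_apply, Pi.add_apply, Pi.smul_apply, smul_eq_mul]
    ring
  simp only [Matrix.one_mulVec, hw] at hm
  rw [sub_dotProduct (w - q) (t • (z - q)), dotProduct_sub (w - q) (w - q) (t • (z - q)),
    dotProduct_sub (t • (z - q)) (w - q) (t • (z - q))] at hm
  simp only [dotProduct_smul, smul_dotProduct, smul_eq_mul] at hm
  rw [dotProduct_comm (z - q) (w - q)] at hm
  linarith

/-- Firm nonexpansiveness of the Euclidean proximity operator. -/
lemma dotProduct_self_le_of_minimizers {g : (Fin N → ℝ) → EReal}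
    (hfin : ∃ z, g z ≠ ⊤) (hbot : ∀ z, g z ≠ ⊥)
    (hconv : ∀ x y : Fin N → ℝ, ∀ a b : ℝ, 0 ≤ a → 0 ≤ b → a + b = 1 →
      g (a • x + b • y) ≤ (a : EReal) * g x + (b : EReal) * g y)
    {w₁ w₂ q₁ q₂ : Fin N → ℝ}
    (h₁ : ∀ z, proxObj 1 g w₁ q₁ ≤ proxObj 1 g w₁ z)
    (h₂ : ∀ z, proxObj 1 g w₂ q₂ ≤ proxObj 1 g w₂ z) :
    (q₁ - q₂) ⬝ᵥ (q₁ - q₂) ≤ (w₁ - w₂) ⬝ᵥ (q₁ - q₂) := by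
  have e₁ := (EReal.coe_toReal (proxObj_one_ne_top h₁ hfin) (hbot q₁)).symm
  have e₂ := (EReal.coe_toReal (proxObj_one_ne_top h₂ hfin) (hbot q₂)).symm
  have i₁ := dotProduct_sub_le_of_minimizer hconv e₁ e₂ h₁
  have i₂ := dotProduct_sub_le_of_minimizer hconv e₂ e₁ h₂
  simp only [sub_dotProduct, dotProduct_sub] at *
  linarith

lemma dotProduct_sq_le (v q : Fin N → ℝ) : (v ⬝ᵥ q) ^ 2 ≤ (v ⬝ᵥ v) * (q ⬝ᵥ q) := by
  simpa only [dotProduct, sq] using Finset.sum_mul_sq_le_sq_mul_sq Finset.univ v q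

end Prox

/-- A continuous real function with increments at least those of the identity is strictly
increasing and has a unique zero. -/
lemma strictMono_and_existsUnique_zero {p : ℝ → ℝ} (hcont : Continuous p)
    (hp : ∀ a b, a ≤ b → b - a ≤ p b - p a) : StrictMono p ∧ ∃! α : ℝ, p α = 0 := by
  have hmono : StrictMono p := fun a b hab => by linarith [hp a b hab.le]
  refine ⟨hmono, ?_⟩
  have hneg : p (-|p 0|) ≤ 0 := by
    have := hp (-|p 0|) 0 (by linarith [abs_nonneg (p 0)])
    linarith [le_abs_self (p 0)]
  have hpos : 0 ≤ p |p 0| := by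
    have := hp 0 |p 0| (abs_nonneg _)
    linarith [neg_abs_le (p 0)]
  obtain ⟨α, hα⟩ := mem_range_of_exists_le_of_exists_ge hcont ⟨_, hneg⟩ ⟨_, hpos⟩
  exact ⟨α, hα, fun β hβ => hmono.injective (hβ.trans hα.symm)⟩

/-- The function `p(α) = ⟨u, x − D^{-1/2} prox_{h∘D^{-1/2}}(D^{1/2}(x − αD⁻¹u))⟩ + α`
is strictly increasing and Lipschitz with constant `1 + Σᵢ uᵢ²/dᵢ`; consequently it
has a unique root. -/
theorem rootFun_strictMono_lipschitz {N : ℕ} (h : (Fin N → ℝ) → EReal) (hh : Gamma0 h)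
    (d : Fin N → ℝ) (hd : ∀ i, 0 < d i) (u : Fin N → ℝ) (x : Fin N → ℝ)
    (Dhalf Dinvhalf Dinv : Matrix (Fin N) (Fin N) ℝ)
    (hDhalf : Dhalf = Matrix.diagonal fun i => Real.sqrt (d i))
    (hDinvhalf : Dinvhalf = Matrix.diagonal fun i => (Real.sqrt (d i))⁻¹)
    (hDinv : Dinv = Matrix.diagonal fun i => (d i)⁻¹)
    -- `P` is the proximity operator of `h ∘ D^{-1/2}` (Euclidean metric)
    (P : (Fin N → ℝ) → (Fin N → ℝ))
    (hP : ∀ w, IsProx 1 (fun z => h (Dinvhalf.mulVec z)) w (P w))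
    (p : ℝ → ℝ)
    (hp : p = fun α =>
      u ⬝ᵥ (x - Dinvhalf.mulVec (P (Dhalf.mulVec (x - α • Dinv.mulVec u)))) + α) :
    StrictMono p ∧
      (∀ a b : ℝ, |p a - p b| ≤ (1 + ∑ i, (u i) ^ 2 / d i) * |a - b|) ∧
      (∃! α : ℝ, p α = 0) := by
  obtain ⟨⟨z₀, hz₀⟩, hbot, -, hconv⟩ := hh
  have hsq : ∀ i, Real.sqrt (d i) ≠ 0 := fun i => (Real.sqrt_pos.2 (hd i)).ne'
  set v : Fin N → ℝ := Dinvhalf *ᵥ u with hv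
  have hvv : v ⬝ᵥ v = ∑ i, (u i) ^ 2 / d i := by
    refine Finset.sum_congr rfl fun i _ => ?_
    rw [hv, hDinvhalf, mulVec_diagonal, mul_mul_mul_comm, ← mul_inv,
      Real.mul_self_sqrt (hd i).le]
    ring
  have hadj : ∀ q, u ⬝ᵥ Dinvhalf *ᵥ q = v ⬝ᵥ q := fun q => by
    refine Finset.sum_congr rfl fun i _ => ?_
    rw [hv, hDinvhalf, mulVec_diagonal, mulVec_diagonal]
    ring
  have harg : ∀ α : ℝ, Dhalf *ᵥ (x - α • Dinv *ᵥ u) = Dhalf *ᵥ x - α • v := fun α => by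
    ext i
    have hi : Real.sqrt (d i) * (d i)⁻¹ = (Real.sqrt (d i))⁻¹ := by
      nth_rewrite 2 [← Real.mul_self_sqrt (hd i).le]
      field_simp [hsq i]
    simp only [hv, hDhalf, hDinv, hDinvhalf, mulVec_diagonal, Pi.sub_apply, Pi.smul_apply,
      smul_eq_mul, ← hi]
    ring
  have hfin : ∃ z, h (Dinvhalf *ᵥ z) ≠ ⊤ := by
    refine ⟨Dhalf *ᵥ z₀, ?_⟩
    convert hz₀ using 2
    ext i
    rw [hDinvhalf, hDhalf, mulVec_diagonal, mulVec_diagonal, inv_mul_cancel_left₀ (hsq i)]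
  have hconv' : ∀ y z : Fin N → ℝ, ∀ a b : ℝ, 0 ≤ a → 0 ≤ b → a + b = 1 →
      h (Dinvhalf *ᵥ (a • y + b • z)) ≤
        (a : EReal) * h (Dinvhalf *ᵥ y) + (b : EReal) * h (Dinvhalf *ᵥ z) := by
    intro y z a b ha hb hab
    rw [mulVec_add, mulVec_smul, mulVec_smul]
    exact hconv _ _ a b ha hb hab
  set Q : ℝ → Fin N → ℝ := fun α => P (Dhalf *ᵥ x - α • v) with hQ
  have hpQ : ∀ α, p α = u ⬝ᵥ x - v ⬝ᵥ Q α + α := fun α => by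
    simp only [hp, harg, dotProduct_sub, hadj, hQ]
  have hfirm : ∀ a b, (Q a - Q b) ⬝ᵥ (Q a - Q b) ≤ (b - a) * (v ⬝ᵥ (Q a - Q b)) := by
    intro a b
    have := dotProduct_self_le_of_minimizers hfin (fun z => hbot _) hconv'
      (hP (Dhalf *ᵥ x - a • v)).1 (hP (Dhalf *ᵥ x - b • v)).1
    rwa [sub_sub_sub_cancel_left, ← sub_smul, smul_dotProduct, smul_eq_mul] at this
  have hdiff : ∀ a b, p b - p a = v ⬝ᵥ (Q a - Q b) + (b - a) := fun a b => by
    rw [hpQ, hpQ, dotProduct_sub]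
    ring
  have hbounds : ∀ a b, a ≤ b → 0 ≤ v ⬝ᵥ (Q a - Q b) ∧
      v ⬝ᵥ (Q a - Q b) ≤ (v ⬝ᵥ v) * (b - a) := by
    intro a b hab
    have hf := hfirm a b
    have hcs := dotProduct_sq_le v (Q a - Q b)
    have hv0 : 0 ≤ v ⬝ᵥ v := Finset.sum_nonneg fun i _ => mul_self_nonneg (v i)
    have hq0 : 0 ≤ (Q a - Q b) ⬝ᵥ (Q a - Q b) :=
      Finset.sum_nonneg fun i _ => mul_self_nonneg ((Q a - Q b) i)
    have hle := hcs.trans (mul_le_mul_of_nonneg_left hf hv0)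
    set s := v ⬝ᵥ (Q a - Q b)
    have hs : s * s ≤ (v ⬝ᵥ v) * (b - a) * s := by linarith
    have hs0 : 0 ≤ s := by
      rcases hab.eq_or_lt with rfl | hlt
      · have : s ^ 2 ≤ 0 := by simpa using hle
        exact (pow_eq_zero_iff two_ne_zero |>.1 (this.antisymm (sq_nonneg s))).ge
      · exact nonneg_of_mul_nonneg_right (hq0.trans hf) (sub_pos.2 hlt)
    refine ⟨hs0, ?_⟩
    rcases hs0.eq_or_lt with h0 | h0
    · exact h0 ▸ mul_nonneg hv0 (sub_nonneg.2 hab)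
    · exact le_of_mul_le_mul_right hs h0
  have hlip : ∀ a b : ℝ, |p a - p b| ≤ (1 + ∑ i, (u i) ^ 2 / d i) * |a - b| := by
    have hord : ∀ a b, a ≤ b → |p a - p b| ≤ (1 + ∑ i, (u i) ^ 2 / d i) * |a - b| := by
      intro a b hab
      obtain ⟨h0, h1⟩ := hbounds a b hab
      rw [abs_sub_comm, abs_sub_comm a, hdiff, abs_of_nonneg (sub_nonneg.2 hab),
        abs_of_nonneg (add_nonneg h0 (sub_nonneg.2 hab)), ← hvv]
      linarith
    intro a b
    rcases le_total a b with hab | hab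
    · exact hord a b hab
    · rw [abs_sub_comm, abs_sub_comm a]
      exact hord b a hab
  have hcont : Continuous p :=
    (LipschitzWith.of_dist_le' (K := 1 + ∑ i, (u i) ^ 2 / d i) hlip).continuous
  obtain ⟨hmono, hroot⟩ := strictMono_and_existsUnique_zero hcont fun a b hab => by
    rw [hdiff]
    linarith [(hbounds a b hab).1]
  exact ⟨hmono, hlip, hroot⟩
end
end

section
/- (Separable diagonal plus rank one case) Let h(x) = Σᵢ hᵢ(xᵢ) with each hᵢ ∈ Γ₀(ℝ), D a diagonal matrix with strictly positive diagonal entries d₁,…,d_N, u ∈ ℝ^N, and V = D + uuᵀ. Fix x ∈ ℝ^N and define p(α) = ⟨u, x − (prox_{hᵢ/dᵢ}(xᵢ − α uᵢ/dᵢ))ᵢ⟩ + α. Then p is Lipschitz continuous and strictly increasing on ℝ, and prox^V_h(x) = (prox_{hᵢ/dᵢ}(xᵢ − α* uᵢ/dᵢ))ᵢ where α* is the unique root of p. -/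
open Matrix

noncomputable section

/-- A scalar function `g : ℝ → ℝ ∪ {+∞}` that is proper, lsc and convex. -/
def Gamma0R (g : ℝ → EReal) : Prop :=
  (∃ t, g t ≠ ⊤) ∧ (∀ t, g t ≠ ⊥) ∧ LowerSemicontinuous g ∧
    ∀ s t : ℝ, ∀ a b : ℝ, 0 ≤ a → 0 ≤ b → a + b = 1 →
      g (a * s + b * t) ≤ (a : EReal) * g s + (b : EReal) * g t

/-- `s = prox_g(t)` for a scalar function `g`: `s` uniquely minimizes
`r ↦ (1/2)(t − r)² + g(r)`. -/
def IsProxR (g : ℝ → EReal) (t s : ℝ) : Prop :=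
  (∀ r : ℝ, (((1 : ℝ) / 2 * (t - s) ^ 2 : ℝ) : EReal) + g s ≤
      (((1 : ℝ) / 2 * (t - r) ^ 2 : ℝ) : EReal) + g r) ∧
    ∀ s' : ℝ, (∀ r : ℝ, (((1 : ℝ) / 2 * (t - s') ^ 2 : ℝ) : EReal) + g s' ≤
      (((1 : ℝ) / 2 * (t - r) ^ 2 : ℝ) : EReal) + g r) → s' = s

open Finset in
theorem EReal.coe_sum_real {ι : Type*} (s : Finset ι) (f : ι → ℝ) :
    ((∑ i ∈ s, f i : ℝ) : EReal) = ∑ i ∈ s, (f i : EReal) := by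
  classical
  induction s using Finset.induction_on with
  | empty => simp
  | insert i s hi ih => rw [sum_insert hi, sum_insert hi, EReal.coe_add, ih]

open Finset in
theorem EReal.sum_ne_bot_of_forall {ι : Type*} (s : Finset ι) (f : ι → EReal)
    (hf : ∀ i, f i ≠ ⊥) : ∑ i ∈ s, f i ≠ ⊥ := by
  classical
  induction s using Finset.induction_on with
  | empty => simp
  | insert i s hi ih =>
    rw [sum_insert hi]
    exact EReal.add_ne_bot_iff.2 ⟨hf i, ih⟩

open Finset in
/-- A finite sum of extended reals, none of them `⊥`, is `⊤` unless all terms are real. -/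
theorem EReal.exists_real_of_sum_ne_top {ι : Type*} [Fintype ι] (f : ι → EReal)
    (hf : ∀ i, f i ≠ ⊥) (hs : ∑ i, f i ≠ ⊤) : ∃ b : ι → ℝ, ∀ i, f i = b i := by
  classical
  refine ⟨fun i => (f i).toReal, fun i => (EReal.coe_toReal (fun h => hs ?_) (hf i)).symm⟩
  rw [← Finset.add_sum_erase _ _ (mem_univ i), h]
  exact EReal.top_add_of_ne_bot (EReal.sum_ne_bot_of_forall _ _ hf)

theorem nonpos_of_forall_le_mul {X Y : ℝ} (hY : 0 ≤ Y)
    (H : ∀ l : ℝ, 0 < l → l ≤ 1 → X ≤ l * Y) : X ≤ 0 := by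
  by_contra! hX
  have hpos : 0 < X + Y + 1 := by linarith
  have h1 := H (X / (X + Y + 1)) (by positivity) ((div_le_one hpos).2 (by linarith))
  rw [div_mul_eq_mul_div, le_div_iff₀ hpos] at h1
  nlinarith [mul_pos hX hX]

/-- The variational inequality characterizing the scalar proximity operator of `g / d`. -/
theorem IsProxR.variational {g : ℝ → EReal} (hg : Gamma0R g) {d t s : ℝ} (hd : 0 < d)
    (hs : IsProxR (fun r => ((d⁻¹ : ℝ) : EReal) * g r) t s) :
    ∃ a : ℝ, g s = a ∧ ∀ r b : ℝ, g r = b → a + d * (t - s) * (r - s) ≤ b := by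
  obtain ⟨⟨r₀, hr₀⟩, hbot, -, hconv⟩ := hg
  obtain ⟨hmin, -⟩ := hs
  have hlift : ∀ r, g r ≠ ⊤ → ∃ b : ℝ, g r = b := fun r hr =>
    ⟨(g r).toReal, (EReal.coe_toReal hr (hbot r)).symm⟩
  have hfin : g s ≠ ⊤ := by
    intro htop
    obtain ⟨b, hb⟩ := hlift r₀ hr₀
    have h1 := hmin r₀
    simp only [htop, hb] at h1
    rw [EReal.coe_mul_top_of_pos (inv_pos.2 hd), EReal.coe_add_top, ← EReal.coe_mul,
      ← EReal.coe_add, top_le_iff] at h1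
    exact EReal.coe_ne_top _ h1
  obtain ⟨a, ha⟩ := hlift s hfin
  refine ⟨a, ha, fun r b hb => ?_⟩
  have key : a + d * (t - s) * (r - s) - b ≤ 0 := by
    refine nonpos_of_forall_le_mul (Y := d * (r - s) ^ 2 / 2) (by positivity) fun l hl hl1 => ?_
    have hc := hconv r s l (1 - l) hl.le (by linarith) (by ring)
    rw [ha, hb, ← EReal.coe_mul, ← EReal.coe_mul, ← EReal.coe_add] at hc
    obtain ⟨c, hc'⟩ := hlift (l * r + (1 - l) * s) (ne_top_of_le_ne_top (EReal.coe_ne_top _) hc)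
    have hm := hmin (l * r + (1 - l) * s)
    simp only [ha, hc'] at hm
    rw [← EReal.coe_mul, ← EReal.coe_mul, ← EReal.coe_add, ← EReal.coe_add,
      EReal.coe_le_coe_iff] at hm
    rw [hc', EReal.coe_le_coe_iff] at hc
    have hm' := mul_le_mul_of_nonneg_left hm hd.le
    rw [mul_add, mul_add, mul_inv_cancel_left₀ hd.ne', mul_inv_cancel_left₀ hd.ne'] at hm'
    refine le_of_mul_le_mul_left ?_ hl
    nlinarith
  linarith

/-- The scalar proximity operator is firmly nonexpansive. -/
theorem IsProxR.firmly_nonexpansive {g : ℝ → EReal} (hg : Gamma0R g) {d t t' s s' : ℝ}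
    (hd : 0 < d) (hs : IsProxR (fun r => ((d⁻¹ : ℝ) : EReal) * g r) t s)
    (hs' : IsProxR (fun r => ((d⁻¹ : ℝ) : EReal) * g r) t' s') :
    (s - s') ^ 2 ≤ (t - t') * (s - s') := by
  obtain ⟨a, ha, hav⟩ := hs.variational hg hd
  obtain ⟨a', ha', hav'⟩ := hs'.variational hg hd
  have h1 := hav s' a' ha'
  have h2 := hav' s a ha
  refine le_of_mul_le_mul_left ?_ hd
  nlinarith

theorem quadForm_diag_add_rank_one {ι : Type*} [Fintype ι] [DecidableEq ι] (d u w : ι → ℝ) :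
    w ⬝ᵥ (Matrix.diagonal d + Matrix.vecMulVec u u).mulVec w =
      ∑ i, d i * w i ^ 2 + (∑ i, u i * w i) ^ 2 := by
  rw [Matrix.add_mulVec, dotProduct_add, Matrix.vecMulVec_mulVec]
  congr 1
  · exact Finset.sum_congr rfl fun i _ => by rw [Matrix.mulVec_diagonal]; ring
  · simp only [dotProduct, Pi.smul_apply, MulOpposite.smul_eq_mul_unop, MulOpposite.unop_op,
      pow_two, Finset.sum_mul]
    exact Finset.sum_congr rfl fun i _ => by ring

/-- Increments of `α ↦ u * (x - prox (x - α * u / d))` have the sign of the increment of `α`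
and are controlled by `u ^ 2 / d`. -/
theorem increment_bounds {u d x α β s s' : ℝ} (hd : 0 < d) (hαβ : α ≤ β)
    (H : (s - s') ^ 2 ≤ ((x - α * u / d) - (x - β * u / d)) * (s - s')) :
    u * (x - s) ≤ u * (x - s') ∧ u * (x - s') ≤ u * (x - s) + u ^ 2 / d * (β - α) := by
  have e : (x - α * u / d) - (x - β * u / d) = (β - α) * (u / d) := by ring
  rw [e] at H
  obtain rfl | hlt := hαβ.eq_or_lt
  · have h0 : s - s' = 0 := by nlinarith
    obtain rfl : s = s' := by linarith
    simp
  have hβ : 0 < β - α := by linarith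
  set v := u / d with hv
  have hu : u = d * v := by rw [hv]; field_simp
  have hud : u ^ 2 / d = d * v ^ 2 := by rw [hu]; field_simp
  have h1 : 0 ≤ v * (s - s') := by
    by_contra! hneg
    nlinarith [mul_neg_of_pos_of_neg hβ hneg, sq_nonneg (s - s')]
  have h2 : v * (s - s') ≤ v ^ 2 * (β - α) := by
    refine le_of_mul_le_mul_left (a := β - α) ?_ hβ
    nlinarith [sq_nonneg ((s - s') - (β - α) * v)]
  rw [hud, hu]
  constructor <;> nlinarith

/-- Separable diagonal plus rank one case: with `h(x) = Σᵢ hᵢ(xᵢ)` and `V = D + uuᵀ`,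
the function `p(α) = ⟨u, x − (prox_{hᵢ/dᵢ}(xᵢ − αuᵢ/dᵢ))ᵢ⟩ + α` is Lipschitz and strictly
increasing, and `prox^V_h(x) = (prox_{hᵢ/dᵢ}(xᵢ − α*uᵢ/dᵢ))ᵢ` at its unique root `α*`. -/
theorem prox_separable_diag_rank_one {N : ℕ} (h : Fin N → ℝ → EReal)
    (hh : ∀ i, Gamma0R (h i))
    (d : Fin N → ℝ) (hd : ∀ i, 0 < d i) (u : Fin N → ℝ) (x : Fin N → ℝ)
    (V : Matrix (Fin N) (Fin N) ℝ)
    (hV : V = Matrix.diagonal d + Matrix.vecMulVec u u)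
    -- `P i` is the proximity operator of `hᵢ/dᵢ`
    (P : Fin N → ℝ → ℝ)
    (hP : ∀ i t, IsProxR (fun s => (((d i)⁻¹ : ℝ) : EReal) * h i s) t (P i t))
    (p : ℝ → ℝ)
    (hp : p = fun α => u ⬝ᵥ (x - fun i => P i (x i - α * u i / d i)) + α) :
    (∃ K : NNReal, LipschitzWith K p) ∧ StrictMono p ∧ (∃! α : ℝ, p α = 0) ∧
      ∀ α : ℝ, p α = 0 →
        IsProx V (fun z => ∑ i, h i (z i)) x (fun i => P i (x i - α * u i / d i)) := by
  have hfne : ∀ i t t', (P i t - P i t') ^ 2 ≤ (t - t') * (P i t - P i t') := fun i t t' =>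
    (hP i t).firmly_nonexpansive (hh i) (hd i) (hP i t')
  have hpv : ∀ α, p α = ∑ i, u i * (x i - P i (x i - α * u i / d i)) + α := fun α => by
    rw [hp]; rfl
  have hbd : ∀ α β, α ≤ β →
      p α + (β - α) ≤ p β ∧ p β ≤ p α + (1 + ∑ i, u i ^ 2 / d i) * (β - α) := by
    intro α β hαβ
    have hb i := increment_bounds (hd i) hαβ (hfne i (x i - α * u i / d i) (x i - β * u i / d i))
    have h1 := Finset.sum_le_sum fun i (_ : i ∈ Finset.univ) => (hb i).1
    have h2 := Finset.sum_le_sum fun i (_ : i ∈ Finset.univ) => (hb i).2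
    rw [Finset.sum_add_distrib, ← Finset.sum_mul] at h2
    rw [hpv, hpv]
    constructor <;> linarith
  have hmono : StrictMono p := fun α β hαβ => by linarith [(hbd α β hαβ.le).1]
  have hK : 0 ≤ 1 + ∑ i, u i ^ 2 / d i :=
    add_nonneg zero_le_one (Finset.sum_nonneg fun i _ => div_nonneg (sq_nonneg _) (hd i).le)
  have hlip : LipschitzWith ⟨_, hK⟩ p := by
    refine LipschitzWith.of_le_add_mul _ fun α β => ?_
    change p α ≤ p β + (1 + ∑ i, u i ^ 2 / d i) * dist α β
    rcases le_total α β with hαβ | hαβ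
    · exact (hmono.monotone hαβ).trans (le_add_of_nonneg_right (mul_nonneg hK dist_nonneg))
    · rw [Real.dist_eq, abs_of_nonneg (sub_nonneg.2 hαβ)]
      exact (hbd β α hαβ).2
  refine ⟨⟨_, hlip⟩, hmono, ?_, fun α hα => ?_⟩
  · have hpos := (hbd 0 |p 0| (abs_nonneg _)).1
    have hneg := (hbd (-|p 0|) 0 (neg_nonpos.2 (abs_nonneg _))).1
    have hmem : (0 : ℝ) ∈ Set.Icc (p (-|p 0|)) (p |p 0|) :=
      ⟨by linarith [le_abs_self (p 0)], by linarith [neg_abs_le (p 0)]⟩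
    obtain ⟨α, -, hα⟩ := intermediate_value_Icc (neg_le_self (abs_nonneg (p 0)))
      hlip.continuous.continuousOn hmem
    exact ⟨α, hα, fun β hβ => hmono.injective (hβ.trans hα.symm)⟩
  · rw [hpv] at hα
    choose a ha hav using fun i => (hP i (x i - α * u i / d i)).variational (hh i) (hd i)
    set s : Fin N → ℝ := fun i => P i (x i - α * u i / d i) with hs
    have hobj : ∀ (z b : Fin N → ℝ), (∀ i, h i (z i) = b i) →
        proxObj V (fun z => ∑ i, h i (z i)) x z =
          ((1 / 2 * (∑ i, d i * (x i - z i) ^ 2 + (∑ i, u i * (x i - z i)) ^ 2) +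
            ∑ i, b i : ℝ) : EReal) := by
      intro z b hb
      simp only [proxObj, hV, quadForm_diag_add_rank_one, hb, Pi.sub_apply]
      rw [← EReal.coe_sum_real, ← EReal.coe_add]
    have htop : ∀ z, (¬ ∃ b : Fin N → ℝ, ∀ i, h i (z i) = b i) →
        proxObj V (fun z => ∑ i, h i (z i)) x z = ⊤ := by
      intro z hz
      have : ∑ i, h i (z i) = ⊤ := by
        by_contra hne
        exact hz (EReal.exists_real_of_sum_ne_top _ (fun i => (hh i).2.1 (z i)) hne)
      simp only [proxObj, this, EReal.coe_add_top]
    have hgap : ∀ (z b : Fin N → ℝ), (∀ i, h i (z i) = b i) →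
        (1 / 2 * (∑ i, d i * (x i - s i) ^ 2 + (∑ i, u i * (x i - s i)) ^ 2) + ∑ i, a i) +
          1 / 2 * ∑ i, d i * (z i - s i) ^ 2 ≤
        1 / 2 * (∑ i, d i * (x i - z i) ^ 2 + (∑ i, u i * (x i - z i)) ^ 2) + ∑ i, b i := by
      intro z b hb
      have hi : ∀ i, a i + d i * (x i - s i) ^ 2 / 2 + d i * (z i - s i) ^ 2 / 2
          - α * (u i * (x i - s i) - u i * (x i - z i)) ≤ b i + d i * (x i - z i) ^ 2 / 2 := by
        intro i
        have h1 := hav i (z i) (b i) (hb i)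
        have h2 : d i * (x i - α * u i / d i - s i) = d i * (x i - s i) - α * u i := by
          have := (hd i).ne'
          field_simp
          ring
        change a i + d i * (x i - α * u i / d i - s i) * (z i - s i) ≤ b i at h1
        rw [h2] at h1
        nlinarith
      have hsum := Finset.sum_le_sum fun i (_ : i ∈ Finset.univ) => hi i
      simp only [Finset.sum_add_distrib, Finset.sum_sub_distrib, ← Finset.sum_div,
        ← Finset.mul_sum] at hsum
      have hα' : ∑ i, u i * (x i - s i) = -α := by linarith
      rw [hα'] at hsum ⊢
      nlinarith [sq_nonneg (∑ i, u i * (x i - z i) + α)]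
    have hnonneg : ∀ z : Fin N → ℝ, ∀ i ∈ Finset.univ, 0 ≤ d i * (z i - s i) ^ 2 :=
      fun z i _ => mul_nonneg (hd i).le (sq_nonneg _)
    refine ⟨fun z => ?_, fun q hq => ?_⟩
    · by_cases hz : ∃ b : Fin N → ℝ, ∀ i, h i (z i) = b i
      · obtain ⟨b, hb⟩ := hz
        rw [hobj z b hb, hobj s a ha, EReal.coe_le_coe_iff]
        linarith [hgap z b hb, Finset.sum_nonneg (hnonneg z)]
      · rw [htop z hz]
        exact le_top
    · have hqs := hq s
      rw [hobj s a ha] at hqs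
      obtain ⟨b, hb⟩ : ∃ b : Fin N → ℝ, ∀ i, h i (q i) = b i := by
        by_contra hz
        rw [htop q hz, top_le_iff] at hqs
        exact EReal.coe_ne_top _ hqs
      rw [hobj q b hb, EReal.coe_le_coe_iff] at hqs
      have hzero : ∑ i, d i * (q i - s i) ^ 2 = 0 :=
        le_antisymm (by linarith [hgap q b hb]) (Finset.sum_nonneg (hnonneg q))
      funext i
      have := (Finset.sum_eq_zero_iff_of_nonneg (hnonneg q)).1 hzero i (Finset.mem_univ i)
      simpa [(hd i).ne', sub_eq_zero] using this
end
end

section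
/- Let h(x) = Σᵢ hᵢ(xᵢ) with each hᵢ ∈ Γ₀(ℝ), D diagonal with strictly positive entries dᵢ, u ∈ ℝ^N with all uᵢ ≠ 0, x ∈ ℝ^N, and suppose for each i that prox_{hᵢ/dᵢ} : ℝ → ℝ is piecewise affine: there are breakpoints tᵢ,₁ < … < tᵢ,_{kᵢ+1} (possibly ±∞ at the ends) such that prox_{hᵢ/dᵢ} is affine on each interval [tᵢ,ⱼ, tᵢ,ⱼ₊₁]. Then the function p(α) = ⟨u, x − (prox_{hᵢ/dᵢ}(xᵢ − α uᵢ/dᵢ))ᵢ⟩ + α is piecewise affine on ℝ, and it is affine on every interval that contains none of the at most k = Σᵢ kᵢ transition points (dᵢ/uᵢ)(xᵢ − tᵢ,ⱼ) in its interior. -/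
open Matrix

noncomputable section

/-- `f : ℝ → ℝ` is affine (agrees with `s ↦ c·s + e`) on every closed interval whose
interior contains no point of the breakpoint set `T`. -/
def AffineOffBreakpoints (f : ℝ → ℝ) (T : Finset ℝ) : Prop :=
  ∀ a b : ℝ, a ≤ b → (∀ t ∈ T, t ∉ Set.Ioo a b) →
    ∃ c e : ℝ, ∀ s ∈ Set.Icc a b, f s = c * s + e

/-- Precomposing with a nonconstant affine map `α ↦ x - α * m` moves a breakpoint `t`
to `(x - t) / m`. -/
theorem AffineOffBreakpoints.comp_sub_mul {f : ℝ → ℝ} {T : Finset ℝ}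
    (hf : AffineOffBreakpoints f T) {m : ℝ} (hm : m ≠ 0) (x : ℝ) {a b : ℝ} (hab : a ≤ b)
    (hT : ∀ t ∈ T, (x - t) / m ∉ Set.Ioo a b) :
    ∃ c e : ℝ, ∀ α ∈ Set.Icc a b, f (x - α * m) = c * α + e := by
  rcases hm.lt_or_gt with hm | hm
  · obtain ⟨c, e, hce⟩ := hf (x - a * m) (x - b * m) (by nlinarith) fun t ht ⟨h₁, h₂⟩ =>
      hT t ht ⟨by rw [lt_div_iff_of_neg hm]; linarith, by rw [div_lt_iff_of_neg hm]; linarith⟩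
    refine ⟨-(c * m), c * x + e, fun α ⟨h₁, h₂⟩ => ?_⟩
    rw [hce _ ⟨by nlinarith, by nlinarith⟩]
    ring
  · obtain ⟨c, e, hce⟩ := hf (x - b * m) (x - a * m) (by nlinarith) fun t ht ⟨h₁, h₂⟩ =>
      hT t ht ⟨by rw [lt_div_iff₀ hm]; linarith, by rw [div_lt_iff₀ hm]; linarith⟩
    refine ⟨-(c * m), c * x + e, fun α ⟨h₁, h₂⟩ => ?_⟩
    rw [hce _ ⟨by nlinarith, by nlinarith⟩]
    ring

/-- If each `prox_{hᵢ/dᵢ}` is piecewise affine with breakpoints `T i`, then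
`p(α) = ⟨u, x − (prox_{hᵢ/dᵢ}(xᵢ − αuᵢ/dᵢ))ᵢ⟩ + α` is piecewise affine: it is affine on
every interval containing none of the transition points `(dᵢ/uᵢ)(xᵢ − tᵢⱼ)` in its
interior. -/
theorem rootFun_piecewise_affine {N : ℕ} (h : Fin N → ℝ → EReal)
    (hh : ∀ i, Gamma0R (h i))
    (d : Fin N → ℝ) (hd : ∀ i, 0 < d i) (u : Fin N → ℝ) (hu : ∀ i, u i ≠ 0)
    (x : Fin N → ℝ)
    -- `P i` is the proximity operator of `hᵢ/dᵢ`
    (P : Fin N → ℝ → ℝ)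
    (hP : ∀ i t, IsProxR (fun s => (((d i)⁻¹ : ℝ) : EReal) * h i s) t (P i t))
    -- each `P i` is piecewise affine with (finitely many) breakpoints `T i`
    (T : Fin N → Finset ℝ)
    (hPA : ∀ i, AffineOffBreakpoints (P i) (T i))
    (p : ℝ → ℝ)
    (hp : p = fun α => u ⬝ᵥ (x - fun i => P i (x i - α * u i / d i)) + α)
    -- the set of transition points
    (S : Set ℝ) (hS : S = {β : ℝ | ∃ i, ∃ t ∈ T i, β = d i / u i * (x i - t)}) :
    ∀ a b : ℝ, a ≤ b → (∀ β ∈ S, β ∉ Set.Ioo a b) →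
      ∃ c e : ℝ, ∀ α ∈ Set.Icc a b, p α = c * α + e := by
  intro a b hab hβ
  have key (i : Fin N) :
      ∃ c e : ℝ, ∀ α ∈ Set.Icc a b, P i (x i - α * (u i / d i)) = c * α + e := by
    refine (hPA i).comp_sub_mul (div_ne_zero (hu i) (hd i).ne') (x i) hab fun t ht => ?_
    have hβt := hβ (d i / u i * (x i - t)) (hS ▸ ⟨i, t, ht, rfl⟩)
    rwa [div_div_eq_mul_div, mul_div_right_comm, div_mul_eq_mul_div, mul_comm (x i - t),
      ← div_mul_eq_mul_div]
  choose c e hce using key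
  refine ⟨1 - ∑ i, u i * c i, ∑ i, u i * (x i - e i), fun α hα => ?_⟩
  have hsum : u ⬝ᵥ (x - fun i => P i (x i - α * u i / d i)) =
      ∑ i, (u i * (x i - e i) - u i * c i * α) := by
    refine Finset.sum_congr rfl fun i _ => ?_
    rw [Pi.sub_apply, mul_div_assoc, hce i α hα]
    ring
  simp only [hp, hsum, Finset.sum_sub_distrib, ← Finset.sum_mul]
  ring
end
end

section
/- (Strict monotonicity from firm nonexpansiveness) Let P : ℝ^N → ℝ^N be firmly nonexpansive, i.e. ⟨P(a) − P(b), a − b⟩ ≥ ‖P(a) − P(b)‖² for all a, b. Fix z, q ∈ ℝ^N and define p(α) = α − ⟨q, P(z − αq)⟩. Then for all real β > α, p(β) − p(α) ≥ (β − α) + (β − α)⁻¹‖P(z − βq) − P(z − αq)‖² > 0; in particular p is strictly increasing on ℝ. -/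
open Matrix

noncomputable section

/-- Strict monotonicity from firm nonexpansiveness: if `P` is firmly nonexpansive and
`p(α) = α − ⟨q, P(z − αq)⟩`, then for `β > α`,
`p(β) − p(α) ≥ (β − α) + (β − α)⁻¹‖P(z − βq) − P(z − αq)‖² > 0`;
in particular `p` is strictly increasing. -/
theorem strictMono_of_firmly_nonexpansive {N : ℕ}
    (P : (Fin N → ℝ) → (Fin N → ℝ))
    (hP : ∀ a b : Fin N → ℝ, (P a - P b) ⬝ᵥ (P a - P b) ≤ (P a - P b) ⬝ᵥ (a - b))
    (z q : Fin N → ℝ) (p : ℝ → ℝ)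
    (hp : p = fun α => α - q ⬝ᵥ P (z - α • q)) :
    (∀ α β : ℝ, α < β →
      (β - α) + (β - α)⁻¹ *
          ((P (z - β • q) - P (z - α • q)) ⬝ᵥ (P (z - β • q) - P (z - α • q))) ≤
        p β - p α ∧
      0 < (β - α) + (β - α)⁻¹ *
          ((P (z - β • q) - P (z - α • q)) ⬝ᵥ (P (z - β • q) - P (z - α • q)))) ∧
    StrictMono p := by
  subst hp
  have key : ∀ α β : ℝ, α < β →
      (β - α) + (β - α)⁻¹ *
          ((P (z - β • q) - P (z - α • q)) ⬝ᵥ (P (z - β • q) - P (z - α • q))) ≤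
        (β - q ⬝ᵥ P (z - β • q)) - (α - q ⬝ᵥ P (z - α • q)) ∧
      0 < (β - α) + (β - α)⁻¹ *
          ((P (z - β • q) - P (z - α • q)) ⬝ᵥ (P (z - β • q) - P (z - α • q))) := by
    intro α β h
    have hpos : 0 < β - α := sub_pos.2 h
    have hfne := hP (z - β • q) (z - α • q)
    have hdiff : (z - β • q) - (z - α • q) = -((β - α) • q) := by
      module
    rw [hdiff, dotProduct_neg, dotProduct_smul, smul_eq_mul, ← mul_neg, dotProduct_comm _ q,
      ← inv_mul_le_iff₀ hpos, dotProduct_sub q] at hfne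
    have hsq : 0 ≤ (P (z - β • q) - P (z - α • q)) ⬝ᵥ (P (z - β • q) - P (z - α • q)) :=
      Finset.sum_nonneg fun i _ => mul_self_nonneg _
    exact ⟨by linarith, by positivity⟩
  exact ⟨key, fun α β h => sub_pos.1 ((key α β h).2.trans_le (key α β h).1)⟩
end
end

section
/- (Projection onto the nonnegative orthant in a scaled norm) Let D be diagonal with strictly positive entries dᵢ, u ∈ ℝ^N, V = D + uuᵀ, and x ∈ ℝ^N. Define ĥ(α) = α − Σᵢ uᵢ·max(0, −(xᵢ + α uᵢ)/dᵢ). If α* is a root of ĥ, then the point y with coordinates yᵢ = max(0, xᵢ + α* uᵢ) is the unique minimizer of (1/2)‖y − x‖²_{V⁻¹} over {y ∈ ℝ^N : y ≥ 0}. -/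
open Matrix

noncomputable section

theorem Matrix.posDef_diagonal_add_vecMulVec {n : Type*} [Fintype n] [DecidableEq n] {d : n → ℝ}
    (hd : ∀ i, 0 < d i) (u : n → ℝ) : (diagonal d + vecMulVec u u).PosDef := by
  refine (PosDef.diagonal hd).add_posSemidef ?_
  simpa using posSemidef_vecMulVec_self_star u

/-- Second-order expansion of the quadratic form of a symmetric matrix. -/
theorem Matrix.dotProduct_mulVec_add_self {n R : Type*} [Fintype n] [CommRing R] {M : Matrix n n R}
    (hM : M.IsSymm) (a b : n → R) :
    (a + b) ⬝ᵥ M *ᵥ (a + b) = a ⬝ᵥ M *ᵥ a + 2 * (b ⬝ᵥ M *ᵥ a) + b ⬝ᵥ M *ᵥ b := by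
  have h : a ⬝ᵥ M *ᵥ b = b ⬝ᵥ M *ᵥ a := by
    rw [dotProduct_mulVec, ← mulVec_transpose, hM.eq, dotProduct_comm]
  rw [mulVec_add, add_dotProduct, dotProduct_add, dotProduct_add, h]
  ring

/-- KKT sufficiency for projecting onto the nonnegative orthant in the norm of a positive definite
matrix `M`, with the slack of the optimality inequality made explicit. -/
theorem Matrix.PosDef.quadratic_growth_of_kkt {n : Type*} [Fintype n] {M : Matrix n n ℝ}
    (hM : M.PosDef) {x y : n → ℝ} (hnonneg : ∀ i, 0 ≤ (M *ᵥ (y - x)) i)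
    (hcompl : ∀ i, y i * (M *ᵥ (y - x)) i = 0) {w : n → ℝ} (hw : ∀ i, 0 ≤ w i) :
    (y - x) ⬝ᵥ M *ᵥ (y - x) + (w - y) ⬝ᵥ M *ᵥ (w - y) ≤ (w - x) ⬝ᵥ M *ᵥ (w - x) := by
  have hsymm : M.IsSymm := by
    simpa [IsHermitian, IsSymm] using hM.isHermitian
  have hcross : 0 ≤ (w - y) ⬝ᵥ M *ᵥ (y - x) := by
    refine Finset.sum_nonneg fun i _ => ?_
    rw [Pi.sub_apply, sub_mul, hcompl, sub_zero]
    exact mul_nonneg (hw i) (hnonneg i)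
  have hexp := dotProduct_mulVec_add_self hsymm (y - x) (w - y)
  rw [show y - x + (w - y) = w - x by abel] at hexp
  linarith

/-- Projection onto the nonnegative orthant in the `V⁻¹`-scaled norm, `V = D + uuᵀ`:
if `α*` is a root of `ĥ(α) = α − Σᵢ uᵢ·max(0, −(xᵢ + αuᵢ)/dᵢ)`, then
`yᵢ = max(0, xᵢ + α*uᵢ)` is the unique minimizer of `(1/2)‖y − x‖²_{V⁻¹}` over `y ≥ 0`. -/
theorem proj_orthant_scaled {N : ℕ}
    (d : Fin N → ℝ) (hd : ∀ i, 0 < d i) (u : Fin N → ℝ) (x : Fin N → ℝ)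
    (V : Matrix (Fin N) (Fin N) ℝ)
    (hV : V = Matrix.diagonal d + Matrix.vecMulVec u u)
    (α : ℝ)
    (hroot : α - ∑ i, u i * max 0 (-(x i + α * u i) / d i) = 0)
    (y : Fin N → ℝ) (hy : y = fun i => max 0 (x i + α * u i)) :
    (∀ i, 0 ≤ y i) ∧
      (∀ w : Fin N → ℝ, (∀ i, 0 ≤ w i) →
        (1 : ℝ) / 2 * ((y - x) ⬝ᵥ V⁻¹.mulVec (y - x)) ≤
          (1 : ℝ) / 2 * ((w - x) ⬝ᵥ V⁻¹.mulVec (w - x))) ∧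
      ∀ w : Fin N → ℝ, (∀ i, 0 ≤ w i) →
        (∀ w' : Fin N → ℝ, (∀ i, 0 ≤ w' i) →
          (1 : ℝ) / 2 * ((w - x) ⬝ᵥ V⁻¹.mulVec (w - x)) ≤
            (1 : ℝ) / 2 * ((w' - x) ⬝ᵥ V⁻¹.mulVec (w' - x))) →
        w = y := by
  have hVpos : V.PosDef := hV ▸ posDef_diagonal_add_vecMulVec hd u
  have hy_nonneg : ∀ i, 0 ≤ y i := fun i => by simp [hy]
  let μ : Fin N → ℝ := fun i => max 0 (-(x i + α * u i) / d i)
  have hVμ : V *ᵥ μ = y - x := by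
    have hα : u ⬝ᵥ μ = α := (sub_eq_zero.mp hroot).symm
    ext i
    have hdμ : d i * μ i = max 0 (-(x i + α * u i)) := by
      simp only [μ]
      rw [mul_max_of_nonneg _ _ (hd i).le, mul_zero, mul_div_cancel₀ _ (hd i).ne']
    have hmax : max 0 (x i + α * u i) - max 0 (-(x i + α * u i)) = x i + α * u i := by
      simpa [max_comm] using max_zero_sub_max_neg_zero_eq_self (x i + α * u i)
    simp only [hV, add_mulVec, vecMulVec_mulVec, hα, Pi.add_apply, mulVec_diagonal, hdμ,
      Pi.smul_apply, Pi.sub_apply, hy, MulOpposite.smul_eq_mul_unop, MulOpposite.unop_op]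
    linarith
  have hμ : V⁻¹ *ᵥ (y - x) = μ := by
    rw [← hVμ, mulVec_mulVec, nonsing_inv_mul _ ((isUnit_iff_isUnit_det V).mp hVpos.isUnit),
      one_mulVec]
  have hgrowth {w : Fin N → ℝ} (hw : ∀ i, 0 ≤ w i) :=
    hVpos.inv.quadratic_growth_of_kkt (x := x) (y := y)
      (fun i => by simp [hμ, μ])
      (fun i => by
        rw [hμ]
        rcases le_total 0 (x i + α * u i) with h | h
        · have : -(x i + α * u i) / d i ≤ 0 :=
            div_nonpos_of_nonpos_of_nonneg (neg_nonpos.mpr h) (hd i).le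
          exact mul_eq_zero_of_right _ (max_eq_left this)
        · simp [hy, max_eq_left h]) hw
  refine ⟨hy_nonneg, fun w hw => ?_, fun w hw hmin => ?_⟩
  · have hpos := hVpos.inv.posSemidef.dotProduct_mulVec_nonneg (w - y)
    rw [star_trivial] at hpos
    linarith [hgrowth hw]
  · by_contra hne
    have hpos := hVpos.inv.dotProduct_mulVec_pos (sub_ne_zero.mpr hne)
    rw [star_trivial] at hpos
    linarith [hgrowth hw, hmin y hy_nonneg]
end
end

section
/- Let D be diagonal with strictly positive entries dᵢ, u ∈ ℝ^N, and x ∈ ℝ^N. The function ĥ(α) = α − Σᵢ uᵢ·max(0, −(xᵢ + α uᵢ)/dᵢ) = α + Σᵢ ((uᵢxᵢ + α uᵢ²)/dᵢ)·χᵢ(α), where χᵢ(α) = 1 if xᵢ + α uᵢ < 0 and 0 otherwise, is strictly increasing on ℝ; in particular it has at most one root, and, being continuous with ĥ(α) → ±∞ as α → ±∞, exactly one root. -/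
noncomputable section

/-- Each summand `u·max(0, −(x + αu)/d)` is nonincreasing in `α`. -/
theorem antitone_mul_max_zero_neg_div {d : ℝ} (hd : 0 < d) (u x : ℝ) :
    Antitone fun α : ℝ => u * max 0 (-(x + α * u) / d) := by
  intro a b hab
  rcases le_total 0 u with hu | hu
  · have h : -(x + b * u) / d ≤ -(x + a * u) / d := by
      gcongr
    exact mul_le_mul_of_nonneg_left (max_le_max le_rfl h) hu
  · have h : -(x + a * u) / d ≤ -(x + b * u) / d :=
      div_le_div_of_nonneg_right (by nlinarith) hd.le
    exact mul_le_mul_of_nonpos_left (max_le_max le_rfl h) hu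

theorem neg_mul_max_zero_neg_div {d : ℝ} (hd : 0 < d) (u x α : ℝ) :
    -(u * max 0 (-(x + α * u) / d)) =
      (u * x + α * u ^ 2) / d * (if x + α * u < 0 then 1 else 0) := by
  split_ifs with h
  · rw [max_eq_right (div_nonneg (by linarith) hd.le)]
    ring
  · rw [max_eq_left (div_nonpos_of_nonpos_of_nonneg (by linarith) hd.le)]
    ring

/-- A continuous real function growing with slope at least one has exactly one root. -/
theorem existsUnique_root_of_sub_le_sub {f : ℝ → ℝ} (hf : Continuous f)
    (h : ∀ a b, a ≤ b → b - a ≤ f b - f a) : ∃! α, f α = 0 := by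
  have hmono : StrictMono f := fun a b hab => by linarith [h a b hab.le]
  have hpos := h 0 |f 0| (abs_nonneg _)
  have hneg := h (-|f 0|) 0 (neg_nonpos.mpr (abs_nonneg _))
  obtain ⟨α, hα⟩ := mem_range_of_exists_le_of_exists_ge (c := 0) hf
    ⟨-|f 0|, by linarith [le_abs_self (f 0)]⟩ ⟨|f 0|, by linarith [neg_abs_le (f 0)]⟩
  exact ⟨α, hα, fun β hβ => hmono.injective (hβ.trans hα.symm)⟩

/-- The function `ĥ(α) = α − Σᵢ uᵢ·max(0, −(xᵢ + αuᵢ)/dᵢ)`, which equals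
`α + Σᵢ ((uᵢxᵢ + αuᵢ²)/dᵢ)·χᵢ(α)` with `χᵢ(α) = 1` if `xᵢ + αuᵢ < 0` and `0` otherwise,
is strictly increasing on `ℝ` and has exactly one root. -/
theorem hhat_strictMono_unique_root {N : ℕ}
    (d : Fin N → ℝ) (hd : ∀ i, 0 < d i) (u : Fin N → ℝ) (x : Fin N → ℝ)
    (hhat : ℝ → ℝ)
    (hdef : hhat = fun α => α - ∑ i, u i * max 0 (-(x i + α * u i) / d i)) :
    (∀ α : ℝ, hhat α =
        α + ∑ i, (u i * x i + α * (u i) ^ 2) / d i *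
          (if x i + α * u i < 0 then 1 else 0)) ∧
      StrictMono hhat ∧ ∃! α : ℝ, hhat α = 0 := by
  subst hdef
  have hslope : ∀ a b : ℝ, a ≤ b → b - a ≤
      (b - ∑ i, u i * max 0 (-(x i + b * u i) / d i)) -
        (a - ∑ i, u i * max 0 (-(x i + a * u i) / d i)) := by
    intro a b hab
    have := Finset.sum_le_sum fun i (_ : i ∈ Finset.univ) =>
      antitone_mul_max_zero_neg_div (hd i) (u i) (x i) hab
    dsimp only at this
    linarith
  refine ⟨fun α => ?_, fun a b hab => ?_, existsUnique_root_of_sub_le_sub ?_ hslope⟩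
  · simp only [← neg_mul_max_zero_neg_div (hd _), Finset.sum_neg_distrib, sub_eq_add_neg]
  · have := hslope a b hab.le
    dsimp only
    linarith
  · fun_prop
end
end
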